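/- Assume R is not Gorenstein (equivalently, r ≥ 2). Let M be a nonzero finitely generated R-module with m²M = 0 such that Ext^{h+1}_R(M, R) = 0 for some integer h ≥ 2. Then (0 :_R m) = m², the first Betti number satisfies β_1^R(M) = e·β_0^R(M) − dim_k(mM), and β_i^R(M) = e·β_{i−1}^R(M) − r·β_{i−2}^R(M) for all 2 ≤ i ≤ h (i.e., M is h-exceptional). -/

import Mathlib

open IsLocalRing CategoryTheory

/-- The length of an `R`-module `M`: the supremum of the lengths of strictly increasing
chains of submodules of `M`.  For a module annihilated by the maximal ideal of a local
ring this coincides with the dimension over the residue field `k`. -/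
noncomputable def moduleLength (R M : Type) [Ring R] [AddCommGroup M] [Module R M] : ℕ∞ :=
  ⨆ p : LTSeries (Submodule R M), (p.length : ℕ∞)

/-- `Ext^n_R(M, N)`, as an object of `ModuleCat R`. -/
noncomputable def extModule (R : Type) [CommRing R] (M N : Type) [AddCommGroup M] [Module R M]
    [AddCommGroup N] [Module R N] (n : ℕ) : ModuleCat R :=
  ((Ext R (ModuleCat R) n).obj (Opposite.op (ModuleCat.of R M))).obj (ModuleCat.of R N)

/-- The `i`-th Betti number `β_i^R(M) = dim_k Ext^i_R(M, k)` of a module `M` over a local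
ring `(R, m, k)`, computed as the length over `R` of `Ext^i_R(M, k)` (an `R`-module
annihilated by `m`, hence a `k`-vector space). -/
noncomputable def bettiNum (R : Type) [CommRing R] [IsLocalRing R] (M : Type) [AddCommGroup M]
    [Module R M] (i : ℕ) : ℕ∞ :=
  moduleLength R (extModule R M (ResidueField R) i).carrier

/-- The `i`-th Bass number `μ^i_R = dim_k Ext^i_R(k, R)` of a local ring `(R, m, k)`. -/
noncomputable def bassNum (R : Type) [CommRing R] [IsLocalRing R] (i : ℕ) : ℕ∞ :=
  moduleLength R (extModule R (ResidueField R) R i).carrier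

/-- The socle `Soc R = (0 :_R m)` of a local ring `(R, m)`. -/
noncomputable def socle (R : Type) [CommRing R] [IsLocalRing R] : Ideal R :=
  Submodule.colon (⊥ : Ideal R) (maximalIdeal R)

/-- The socle dimension `r = dim_k (0 :_R m)` of a local ring `(R, m, k)`. -/
noncomputable def socdim (R : Type) [CommRing R] [IsLocalRing R] : ℕ∞ :=
  moduleLength R (socle R)

/-- The embedding dimension `e = dim_k (m/m²)` of a local ring `(R, m, k)`. -/
noncomputable def embdim (R : Type) [CommRing R] [IsLocalRing R] : ℕ∞ :=
  moduleLength R (CotangentSpace R)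

/-- The residue field `k` is (isomorphic to) a direct summand of the `R`-module `M`,
expressed by a split injection `k → M`. -/
def kSummand (R : Type) [CommRing R] [IsLocalRing R] (M : Type) [AddCommGroup M]
    [Module R M] : Prop :=
  ∃ (f : M →ₗ[R] ResidueField R) (g : ResidueField R →ₗ[R] M), f ∘ₗ g = LinearMap.id


open CategoryTheory.Limits

/-- middle cohomology of `Hom(-, N)` applied to `A → B → C`. -/
abbrev HHom {R : Type} [CommRing R] {A B C : Type} [AddCommGroup A] [Module R A]
    [AddCommGroup B] [Module R B] [AddCommGroup C] [Module R C]
    (f : A →ₗ[R] B) (g : B →ₗ[R] C) (N : Type) [AddCommGroup N] [Module R N] : Type :=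
  (LinearMap.ker (LinearMap.lcomp R N f)) ⧸
    ((LinearMap.range (LinearMap.lcomp R N g)).comap
      (LinearMap.ker (LinearMap.lcomp R N f)).subtype)

lemma sc_homology_equiv {R : Type} [CommRing R] (S : ShortComplex (ModuleCat.{0} R))
    {A B C : Type} [AddCommGroup A] [Module R A]
    [AddCommGroup B] [Module R B] [AddCommGroup C] [Module R C]
    (f : A →ₗ[R] B) (g : B →ₗ[R] C)
    (e1 : S.X₁ ≃ₗ[R] A) (e2 : S.X₂ ≃ₗ[R] B) (e3 : S.X₃ ≃ₗ[R] C)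
    (hf : ∀ x, e2 (S.f.hom x) = f (e1 x)) (hg : ∀ x, e3 (S.g.hom x) = g (e2 x)) :
    Nonempty (S.homology ≃ₗ[R] (LinearMap.ker g) ⧸
      ((LinearMap.range f).comap (LinearMap.ker g).subtype)) := by
  refine ⟨S.moduleCatHomologyIso.toLinearEquiv ≪≫ₗ ?_⟩
  have hk : (LinearMap.ker S.g.hom).map (e2 : S.X₂ →ₗ[R] B) = LinearMap.ker g := by
    ext y
    simp only [Submodule.mem_map, LinearMap.mem_ker]
    constructor
    · rintro ⟨x, hx, rfl⟩
      have := hg x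
      rw [hx] at this
      simpa using this.symm
    · intro hy
      refine ⟨e2.symm y, ?_, by simp⟩
      apply e3.injective
      rw [hg]; simpa using hy
  refine Submodule.Quotient.equiv _ _ (e2.ofSubmodules _ _ hk) ?_
  ext ⟨y, hy⟩
  simp only [Submodule.mem_map, Submodule.mem_comap, LinearMap.mem_range, Submodule.subtype_apply]
  constructor
  · rintro ⟨x, ⟨z, rfl⟩, h⟩
    refine ⟨e1 z, ?_⟩
    rw [← hf]
    exact congrArg Subtype.val h
  · rintro ⟨z, rfl⟩
    refine ⟨_, ⟨e1.symm z, rfl⟩, ?_⟩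
    apply Subtype.ext
    have := hf (e1.symm z)
    rw [LinearEquiv.apply_symm_apply] at this
    exact this

lemma ext_succ_equiv {R : Type} [CommRing R] (X N : Type) [AddCommGroup X] [Module R X]
    [AddCommGroup N] [Module R N] (Q : ProjectiveResolution (ModuleCat.of R X)) (n : ℕ) :
    Nonempty ((extModule R X N (n+1)).carrier ≃ₗ[R]
      HHom (Q.complex.d (n+2) (n+1)).hom (Q.complex.d (n+1) n).hom N) := by
  let K := Q.complex.linearYonedaObj R (ModuleCat.of R N)
  have i1 := (Q.isoExt (R := R) (n+1) (ModuleCat.of R N)).toLinearEquiv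
  have i2 : K.homology (n+1) ≅ (K.sc' n (n+1) (n+2)).homology := 
    ShortComplex.homologyMapIso (K.isoSc' n (n+1) (n+2) (by simp) (by simp))
  obtain ⟨i3⟩ := sc_homology_equiv (K.sc' n (n+1) (n+2))
    (LinearMap.lcomp R N (Q.complex.d (n+1) n).hom) (LinearMap.lcomp R N (Q.complex.d (n+2) (n+1)).hom)
    (ModuleCat.homLinearEquiv (S := R)) (ModuleCat.homLinearEquiv (S := R)) (ModuleCat.homLinearEquiv (S := R)) 
    (fun x => rfl) (fun x => rfl)
  exact ⟨i1 ≪≫ₗ i2.toLinearEquiv ≪≫ₗ i3⟩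

lemma res_exact_zero {R : Type} [CommRing R] {X : Type} [AddCommGroup X] [Module R X]
    (Q : ProjectiveResolution (ModuleCat.of R X)) :
    ∃ p : Q.complex.X 0 →ₗ[R] X, Function.Surjective p ∧
      Function.Exact (Q.complex.d 1 0).hom p := by
  let S : ShortComplex (ModuleCat.{0} R) :=
    ShortComplex.mk (Q.complex.d 1 0) (Q.π.f 0) Q.complex_d_comp_π_f_zero
  have hS : S.Exact := ShortComplex.exact_of_g_is_cokernel S Q.isColimitCokernelCofork
  refine ⟨(Q.π.f 0).hom, ?_, ?_⟩
  · exact (ModuleCat.epi_iff_surjective (Q.π.f 0)).1 inferInstance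
  · exact (ShortComplex.ShortExact.moduleCat_exact_iff_function_exact S).1 hS

/-- Hom is left exact: maps out of a cokernel. -/
noncomputable def homKerEquiv {R : Type} [CommRing R] {A B C : Type} [AddCommGroup A] [Module R A]
    [AddCommGroup B] [Module R B] [AddCommGroup C] [Module R C]
    (f : A →ₗ[R] B) (g : B →ₗ[R] C) (N : Type) [AddCommGroup N] [Module R N]
    (hg : Function.Surjective g) (hfg : Function.Exact f g) :
    (C →ₗ[R] N) ≃ₗ[R] LinearMap.ker (LinearMap.lcomp R N f) :=
  LinearEquiv.ofBijective ((LinearMap.lcomp R N g).codRestrict _ (by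
    intro c
    ext a
    simp [hfg.apply_apply_eq_zero])) (by
    constructor
    · intro c c' h
      ext x
      obtain ⟨b, rfl⟩ := hg x
      exact LinearMap.congr_fun (congrArg Subtype.val h) b
    · rintro ⟨φ, hφ⟩
      have hle : LinearMap.ker g ≤ LinearMap.ker φ := by
        intro b hb
        obtain ⟨a, rfl⟩ := (hfg b).1 hb
        exact LinearMap.congr_fun hφ a
      let e := g.quotKerEquivOfSurjective hg
      refine ⟨((LinearMap.ker g).liftQ φ hle) ∘ₗ e.symm.toLinearMap, ?_⟩
      apply Subtype.ext
      ext b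
      have : e.symm (g b) = Submodule.Quotient.mk b := by
        rw [LinearEquiv.symm_apply_eq]; rfl
      change (LinearMap.ker g).liftQ φ hle (e.symm (g b)) = φ b
      rw [this]
      rfl)

lemma homKerEquiv_apply {R : Type} [CommRing R] {A B C : Type} [AddCommGroup A] [Module R A]
    [AddCommGroup B] [Module R B] [AddCommGroup C] [Module R C]
    (f : A →ₗ[R] B) (g : B →ₗ[R] C) (N : Type) [AddCommGroup N] [Module R N]
    (hg : Function.Surjective g) (hfg : Function.Exact f g) (c : C →ₗ[R] N) :
    (homKerEquiv f g N hg hfg c : B →ₗ[R] N) = c ∘ₗ g := rfl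

lemma ext_zero_equiv {R : Type} [CommRing R] (X N : Type) [AddCommGroup X] [Module R X]
    [AddCommGroup N] [Module R N] :
    Nonempty ((extModule R X N 0).carrier ≃ₗ[R] (X →ₗ[R] N)) := by
  let Q := projectiveResolution (ModuleCat.of R X)
  let K := Q.complex.linearYonedaObj R (ModuleCat.of R N)
  have i1 := (Q.isoExt (R := R) 0 (ModuleCat.of R N)).toLinearEquiv
  have i2 : K.homology 0 ≅ K.cycles 0 := K.isoHomologyπ₀.symm
  have hl := K.cyclesIsKernel 0 1 (by simp)
  have hl' := (ModuleCat.kernelIsLimit (K.d 0 1))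
  have i3 := (hl.conePointUniqueUpToIso hl').toLinearEquiv
  obtain ⟨p, hp, hex⟩ := res_exact_zero Q
  have i4 := homKerEquiv _ _ N hp hex
  have i5 : LinearMap.ker (K.d 0 1).hom ≃ₗ[R]
      LinearMap.ker (LinearMap.lcomp R N (Q.complex.d 1 0).hom) :=
    LinearEquiv.ofSubmodules (ModuleCat.homLinearEquiv (S := R)) _ _ (by
      ext y
      constructor
      · rintro ⟨x, hx, rfl⟩
        exact congrArg ModuleCat.Hom.hom hx
      · intro hy
        exact ⟨ModuleCat.ofHom y, ModuleCat.hom_ext hy, rfl⟩)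
  exact ⟨i1 ≪≫ₗ i2.toLinearEquiv ≪≫ₗ i3 ≪≫ₗ i5 ≪≫ₗ i4.symm⟩

lemma exists_resolution {R : Type} [CommRing R] (C : ChainComplex (ModuleCat.{0} R) ℕ)
    {X : ModuleCat.{0} R} (f : C.X 0 ⟶ X) (w : C.d 1 0 ≫ f = 0)
    (hS : (ShortComplex.mk _ _ w).Exact) (hf : Epi f) (hproj : ∀ n, Projective (C.X n))
    (hC : ∀ n, C.ExactAt (n+1)) :
    ∃ Q : ProjectiveResolution X, Q.complex = C := by
  refine ⟨{ complex := C
            projective := hproj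
            π := (ChainComplex.toSingle₀Equiv C X).symm ⟨f, w⟩
            quasiIso := ⟨fun n => ?_⟩ }, rfl⟩
  cases n
  · rw [ChainComplex.quasiIsoAt₀_iff, ShortComplex.quasiIso_iff_of_zeros']
    · refine (ShortComplex.exact_and_epi_g_iff_of_iso ?_).2 ⟨hS, hf⟩
      refine ShortComplex.isoMk (Iso.refl _) (Iso.refl _) (Iso.refl _) ?_ ?_
      · exact (Category.id_comp _).trans (Category.comp_id _).symm
      · refine (Category.id_comp _).trans (Eq.trans ?_ (Category.comp_id _).symm)
        exact (ChainComplex.toSingle₀Equiv_symm_apply_f_zero _ _).symm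
    all_goals first | rfl | exact C.shape _ _ (by simp)
  · rw [quasiIsoAt_iff_exactAt']
    · apply hC
    · apply ChainComplex.exactAt_succ_single_obj

/-- Splice a resolution of `K` with a short exact sequence `K → P → X`. -/
lemma exists_splice {R : Type} [CommRing R] {X P K : Type} [AddCommGroup X] [Module R X]
    [AddCommGroup P] [Module R P] [AddCommGroup K] [Module R K] [Module.Projective R P]
    (i : K →ₗ[R] P) (π : P →ₗ[R] X) (hi : Function.Injective i) (hπ : Function.Surjective π)
    (hex : Function.Exact i π) (Q : ProjectiveResolution (ModuleCat.of R K))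
    (p : Q.complex.X 0 →ₗ[R] K) (hp : Function.Surjective p)
    (hpe : Function.Exact (Q.complex.d 1 0).hom p) :
    ∃ w, ∃ Q' : ProjectiveResolution (ModuleCat.of R X),
      Q'.complex = Q.complex.augment (X := ModuleCat.of R P) (ModuleCat.ofHom (i ∘ₗ p)) w := by
  have w : Q.complex.d 1 0 ≫ (ModuleCat.ofHom (i ∘ₗ p) : _ ⟶ ModuleCat.of R P) = 0 := by
    ext x
    simp [hpe.apply_apply_eq_zero]
  refine ⟨w, ?_⟩
  have w2 : (ModuleCat.ofHom (i ∘ₗ p) : _ ⟶ ModuleCat.of R P) ≫ ModuleCat.ofHom π = 0 := by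
    ext x
    simp [hex.apply_apply_eq_zero]
  let C := Q.complex.augment (X := ModuleCat.of R P) (ModuleCat.ofHom (i ∘ₗ p)) w
  have hproj : ∀ n, Projective (C.X n) := by
    intro n
    cases n with
    | zero => exact (ModuleCat.of R P).projective_of_categoryTheory_projective
    | succ n => exact Q.projective n
  have hC : ∀ n, C.ExactAt (n+1) := by
    intro n
    rw [HomologicalComplex.exactAt_iff' _ (n + 1 + 1) (n + 1) n (by simp) (by simp)]
    cases n with
    | zero =>
      refine (ShortComplex.ShortExact.moduleCat_exact_iff_function_exact _).2 ?_
      intro x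
      constructor
      · intro hx
        exact (hpe x).1 (hi (hx.trans (map_zero i).symm))
      · rintro ⟨y, rfl⟩
        exact (congrArg i (hpe.apply_apply_eq_zero y)).trans (map_zero i)
    | succ n => exact Q.exact_succ n
  let S0 : ShortComplex (ModuleCat.{0} R) :=
    ShortComplex.mk (C.d 1 0) (ModuleCat.ofHom π : C.X 0 ⟶ ModuleCat.of R X) w2
  have hS0 : S0.Exact := by
    refine (ShortComplex.ShortExact.moduleCat_exact_iff_function_exact _).2 ?_
    intro x
    constructor
    · intro hx
      obtain ⟨k, rfl⟩ := (hex x).1 hx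
      obtain ⟨q, rfl⟩ := hp k
      exact ⟨q, rfl⟩
    · rintro ⟨y, rfl⟩
      exact hex.apply_apply_eq_zero _
  have hS0e : Epi S0.g := (ModuleCat.epi_iff_surjective _).2 hπ
  obtain ⟨Q', hQ'⟩ := exists_resolution C (ModuleCat.ofHom π : C.X 0 ⟶ ModuleCat.of R X) w2
    hS0 hS0e hproj hC
  exact ⟨Q', hQ'⟩

lemma ext_two_equiv {R : Type} [CommRing R] {X P K : Type} [AddCommGroup X] [Module R X]
    [AddCommGroup P] [Module R P] [AddCommGroup K] [Module R K] [Module.Projective R P]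
    (i : K →ₗ[R] P) (π : P →ₗ[R] X) (hi : Function.Injective i) (hπ : Function.Surjective π)
    (hex : Function.Exact i π) (N : Type) [AddCommGroup N] [Module R N] (n : ℕ) :
    Nonempty ((extModule R X N (n+2)).carrier ≃ₗ[R] (extModule R K N (n+1)).carrier) := by
  let Q := projectiveResolution (ModuleCat.of R K)
  obtain ⟨p, hp, hpe⟩ := res_exact_zero Q
  obtain ⟨w, Q', hQ'⟩ := exists_splice i π hi hπ hex Q p hp hpe
  obtain ⟨e⟩ := ext_succ_equiv X N Q' (n+1)
  obtain ⟨e'⟩ := ext_succ_equiv K N Q n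
  revert e
  rw [hQ']
  intro e
  exact ⟨e ≪≫ₗ e'.symm⟩

lemma ext_one_equiv {R : Type} [CommRing R] {X P K : Type} [AddCommGroup X] [Module R X]
    [AddCommGroup P] [Module R P] [AddCommGroup K] [Module R K] [Module.Projective R P]
    (i : K →ₗ[R] P) (π : P →ₗ[R] X) (hi : Function.Injective i) (hπ : Function.Surjective π)
    (hex : Function.Exact i π) (N : Type) [AddCommGroup N] [Module R N] :
    Nonempty ((extModule R X N 1).carrier ≃ₗ[R]
      ((K →ₗ[R] N) ⧸ LinearMap.range (LinearMap.lcomp R N i))) := by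
  let Q := projectiveResolution (ModuleCat.of R K)
  obtain ⟨p, hp, hpe⟩ := res_exact_zero Q
  obtain ⟨w, Q', hQ'⟩ := exists_splice i π hi hπ hex Q p hp hpe
  obtain ⟨e⟩ := ext_succ_equiv X N Q' 0
  revert e
  rw [hQ']
  intro e
  have e2 : HHom (Q.complex.d 1 0).hom (i ∘ₗ p) N ≃ₗ[R]
      ((K →ₗ[R] N) ⧸ LinearMap.range (LinearMap.lcomp R N i)) := by
    refine (Submodule.Quotient.equiv _ _ (homKerEquiv _ _ N hp hpe) ?_).symm
    ext ⟨y, hy⟩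
    simp only [Submodule.mem_map, Submodule.mem_comap, LinearMap.mem_range,
      Submodule.subtype_apply]
    constructor
    · rintro ⟨x, ⟨z, rfl⟩, h⟩
      exact ⟨z, congrArg Subtype.val h⟩
    · rintro ⟨z, rfl⟩
      exact ⟨_, ⟨z, rfl⟩, Subtype.ext rfl⟩
  exact ⟨e ≪≫ₗ e2⟩

/-- vanishing is inherited by retracts -/
lemma ext_retract {R : Type} [CommRing R] {X Y : Type} [AddCommGroup X] [Module R X]
    [AddCommGroup Y] [Module R Y] (N : Type) [AddCommGroup N] [Module R N] (n : ℕ)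
    (f : X →ₗ[R] Y) (g : Y →ₗ[R] X) (hfg : f ∘ₗ g = LinearMap.id)
    (h : Subsingleton (extModule R X N n).carrier) : Subsingleton (extModule R Y N n).carrier := by
  let F := (Ext R (ModuleCat.{0} R) n).flip.obj (ModuleCat.of R N)
  let a : (extModule R Y N n) ⟶ (extModule R X N n) := F.map (ModuleCat.ofHom f).op
  let b : (extModule R X N n) ⟶ (extModule R Y N n) := F.map (ModuleCat.ofHom g).op
  have hab : a ≫ b = 𝟙 _ := by
    refine (F.map_comp _ _).symm.trans ?_
    rw [← op_comp, ← ModuleCat.ofHom_comp, hfg]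
    exact F.map_id _
  constructor
  intro x y
  have key : ∀ x, b.hom (a.hom x) = x := fun x =>
    LinearMap.congr_fun (congrArg ModuleCat.Hom.hom hab) x
  rw [← key x, ← key y, h.elim (a.hom x) (a.hom y)]

/-- `Ext¹(X,N)=0` iff maps extend. -/
lemma ext_one_subsingleton_iff {R : Type} [CommRing R] {X P K : Type} [AddCommGroup X] [Module R X]
    [AddCommGroup P] [Module R P] [AddCommGroup K] [Module R K] [Module.Projective R P]
    (i : K →ₗ[R] P) (π : P →ₗ[R] X) (hi : Function.Injective i) (hπ : Function.Surjective π)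
    (hex : Function.Exact i π) (N : Type) [AddCommGroup N] [Module R N] :
    Subsingleton (extModule R X N 1).carrier ↔ ∀ φ : K →ₗ[R] N, ∃ ψ : P →ₗ[R] N, ψ ∘ₗ i = φ := by
  obtain ⟨e⟩ := ext_one_equiv i π hi hπ hex N
  rw [e.toEquiv.subsingleton_congr, Submodule.Quotient.subsingleton_iff,
    LinearMap.range_eq_top]
  rfl

lemma ext_two_subsingleton_iff {R : Type} [CommRing R] {X P K : Type} [AddCommGroup X] [Module R X]
    [AddCommGroup P] [Module R P] [AddCommGroup K] [Module R K] [Module.Projective R P]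
    (i : K →ₗ[R] P) (π : P →ₗ[R] X) (hi : Function.Injective i) (hπ : Function.Surjective π)
    (hex : Function.Exact i π) (N : Type) [AddCommGroup N] [Module R N] (n : ℕ) :
    Subsingleton (extModule R X N (n+2)).carrier ↔
      Subsingleton (extModule R K N (n+1)).carrier := by
  obtain ⟨e⟩ := ext_two_equiv i π hi hπ hex N n
  exact e.toEquiv.subsingleton_congr

/-- Horseshoe step. -/
lemma horseshoe {R : Type} [CommRing R] {X' X X'' : Type} [AddCommGroup X'] [Module R X']
    [AddCommGroup X] [Module R X] [AddCommGroup X''] [Module R X'']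
    (f : X' →ₗ[R] X) (g : X →ₗ[R] X'') (hf : Function.Injective f) (hg : Function.Surjective g)
    (hfg : Function.Exact f g) {P' P'' : Type} [AddCommGroup P'] [Module R P']
    [AddCommGroup P''] [Module R P''] [Module.Projective R P'']
    (p' : P' →ₗ[R] X') (p'' : P'' →ₗ[R] X'') (hp' : Function.Surjective p')
    (hp'' : Function.Surjective p'') :
    ∃ p : (P' × P'') →ₗ[R] X, Function.Surjective p ∧
      ∃ (a : LinearMap.ker p' →ₗ[R] LinearMap.ker p) (b : LinearMap.ker p →ₗ[R] LinearMap.ker p''),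
        Function.Injective a ∧ Function.Surjective b ∧ Function.Exact a b ∧
        (∀ x, (a x : P' × P'') = (x.1, 0)) ∧ (∀ x, (b x : P'') = x.1.2) := by
  obtain ⟨l, hl⟩ := Module.projective_lifting_property g p'' hg
  have hl' : ∀ x, g (l x) = p'' x := fun x => LinearMap.congr_fun hl x
  let p : (P' × P'') →ₗ[R] X := LinearMap.coprod (f ∘ₗ p') l
  have hpa : ∀ x y, p (x, y) = f (p' x) + l y := fun x y => by simp [p]
  have hgp : ∀ z, g (p z) = p'' z.2 := by
    rintro ⟨x, y⟩
    rw [hpa, map_add, hfg.apply_apply_eq_zero, hl', zero_add]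
  refine ⟨p, ?_, ?_⟩
  · intro x
    obtain ⟨y, hy⟩ := hp'' (g x)
    have : g (x - l y) = 0 := by rw [map_sub, hl', hy, sub_self]
    obtain ⟨z, hz⟩ := (hfg _).1 this
    obtain ⟨t, rfl⟩ := hp' z
    exact ⟨(t, y), by rw [hpa, hz]; abel⟩
  · let a : LinearMap.ker p' →ₗ[R] LinearMap.ker p :=
      (LinearMap.inl R P' P'' ∘ₗ (LinearMap.ker p').subtype).codRestrict _ (by
        rintro ⟨x, hx⟩
        have hx : p' x = 0 := hx
        simp [p, hx])
    let b : LinearMap.ker p →ₗ[R] LinearMap.ker p'' :=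
      (LinearMap.snd R P' P'' ∘ₗ (LinearMap.ker p).subtype).codRestrict _ (by
        rintro ⟨x, hx⟩
        have hx : p x = 0 := hx
        have := hgp x
        rw [hx, map_zero] at this
        exact this.symm)
    have ha : ∀ x, (a x : P' × P'') = (x.1, 0) := fun x => rfl
    have hb : ∀ x, (b x : P'') = x.1.2 := fun x => rfl
    refine ⟨a, b, ?_, ?_, ?_, ha, hb⟩
    · intro x y h
      have := congrArg Subtype.val h
      rw [ha, ha] at this
      exact Subtype.ext (congrArg Prod.fst this)
    · rintro ⟨y, hy⟩
      have hy : p'' y = 0 := hy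
      have : g (l y) = 0 := by rw [hl', hy]
      obtain ⟨z, hz⟩ := (hfg _).1 this
      obtain ⟨t, rfl⟩ := hp' z
      refine ⟨⟨(-t, y), ?_⟩, Subtype.ext rfl⟩
      rw [LinearMap.mem_ker, hpa, map_neg, map_neg, hz]; abel
    · rintro ⟨⟨x, y⟩, h⟩
      constructor
      · intro h0
        have hy : y = 0 := congrArg Subtype.val h0
        subst hy
        rw [LinearMap.mem_ker, hpa, map_zero, add_zero] at h
        exact ⟨⟨x, hf (h.trans (map_zero f).symm)⟩, rfl⟩
      · rintro ⟨z, hz⟩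
        apply Subtype.ext
        rw [hb, ← hz, ha]
        rfl

lemma exact_ker {R : Type} [CommRing R] {P X : Type} [AddCommGroup P] [Module R P]
    [AddCommGroup X] [Module R X] (p : P →ₗ[R] X) :
    Function.Exact (LinearMap.ker p).subtype p := by
  intro x
  simp

lemma exists_cover (R : Type) [CommRing R] (X : Type) [AddCommGroup X] [Module R X] :
    ∃ (P : Type) (_ : AddCommGroup P) (_ : Module R P) (_ : Module.Projective R P)
      (p : P →ₗ[R] X), Function.Surjective p :=
  ⟨X →₀ R, inferInstance, inferInstance, inferInstance, Finsupp.linearCombination R id,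
    Finsupp.linearCombination_id_surjective R X⟩

lemma ext_mid {R : Type} [CommRing R] (N : Type) [AddCommGroup N] [Module R N] (n : ℕ) :
    ∀ {X' X X'' : Type} [AddCommGroup X'] [Module R X']
    [AddCommGroup X] [Module R X] [AddCommGroup X''] [Module R X'']
    (f : X' →ₗ[R] X) (g : X →ₗ[R] X'') (_ : Function.Injective f) (_ : Function.Surjective g)
    (_ : Function.Exact f g), Subsingleton (extModule R X' N (n+1)).carrier →
    Subsingleton (extModule R X'' N (n+1)).carrier →
    Subsingleton (extModule R X N (n+1)).carrier := by
  induction n with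
  | zero =>
    intro X' X X'' _ _ _ _ _ _ f g hf hg hfg h' h''
    obtain ⟨P', _, _, _, p', hp'⟩ := exists_cover R X'
    obtain ⟨P'', _, _, _, p'', hp''⟩ := exists_cover R X''
    obtain ⟨p, hp, a, b, ha, hb, hab, ha', hb'⟩ := horseshoe f g hf hg hfg p' p'' hp' hp''
    rw [ext_one_subsingleton_iff _ _ (Submodule.injective_subtype _) hp' (exact_ker p')] at h'
    rw [ext_one_subsingleton_iff _ _ (Submodule.injective_subtype _) hp'' (exact_ker p'')] at h''
    rw [ext_one_subsingleton_iff _ _ (Submodule.injective_subtype _) hp (exact_ker p)]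
    intro φ
    obtain ⟨ψ', hψ'⟩ := h' (φ ∘ₗ a)
    let φ2 := φ - ψ' ∘ₗ LinearMap.fst R P' P'' ∘ₗ (LinearMap.ker p).subtype
    have hφ2 : φ2 ∈ LinearMap.ker (LinearMap.lcomp R N a) := by
      rw [LinearMap.mem_ker]
      ext x
      have := LinearMap.congr_fun hψ' x
      simp only [LinearMap.comp_apply, Submodule.subtype_apply] at this
      simp [φ2, ha', this]
    obtain ⟨c, hc⟩ := (homKerEquiv a b N hb hab).surjective ⟨φ2, hφ2⟩
    have hc' : c ∘ₗ b = φ2 := congrArg Subtype.val hc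
    obtain ⟨ψ'', hψ''⟩ := h'' c
    refine ⟨LinearMap.coprod ψ' ψ'', ?_⟩
    ext x
    have h1 := LinearMap.congr_fun hψ'' (b x)
    have h2 := LinearMap.congr_fun hc' x
    simp only [LinearMap.comp_apply, Submodule.subtype_apply, hb', φ2, LinearMap.sub_apply,
      LinearMap.fst_apply] at h1 h2
    simp only [LinearMap.comp_apply, Submodule.subtype_apply, LinearMap.coprod_apply]
    rw [h1, h2]; abel
  | succ n ih =>
    intro X' X X'' _ _ _ _ _ _ f g hf hg hfg h' h''
    obtain ⟨P', _, _, _, p', hp'⟩ := exists_cover R X'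
    obtain ⟨P'', _, _, _, p'', hp''⟩ := exists_cover R X''
    obtain ⟨p, hp, a, b, ha, hb, hab, ha', hb'⟩ := horseshoe f g hf hg hfg p' p'' hp' hp''
    rw [ext_two_subsingleton_iff _ _ (Submodule.injective_subtype _) hp' (exact_ker p')] at h'
    rw [ext_two_subsingleton_iff _ _ (Submodule.injective_subtype _) hp'' (exact_ker p'')] at h''
    rw [ext_two_subsingleton_iff _ _ (Submodule.injective_subtype _) hp (exact_ker p)]
    exact ih a b ha hb hab h' h''

lemma ext_equiv_subsingleton {R : Type} [CommRing R] {X Y : Type} [AddCommGroup X] [Module R X]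
    [AddCommGroup Y] [Module R Y] (N : Type) [AddCommGroup N] [Module R N] (n : ℕ)
    (e : X ≃ₗ[R] Y)
    (h : Subsingleton (extModule R X N n).carrier) : Subsingleton (extModule R Y N n).carrier :=
  ext_retract N n e.toLinearMap e.symm.toLinearMap (by ext; simp) h

lemma ext_finiteLength {R : Type} [CommRing R] [IsLocalRing R] (N : Type) [AddCommGroup N]
    [Module R N] (n : ℕ) (hk : Subsingleton (extModule R (ResidueField R) N (n+1)).carrier)
    {X : Type} [AddCommGroup X] [Module R X] (hX : IsFiniteLength R X) :
    Subsingleton (extModule R X N (n+1)).carrier := by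
  induction hX with
  | @of_subsingleton X _ _ _ =>
    exact ext_retract N (n+1) (0 : ResidueField R →ₗ[R] X) 0 (Subsingleton.elim _ _) hk
  | @of_simple_quotient X _ _ Y hs _ ih =>
    refine ext_mid N n Y.subtype Y.mkQ Y.injective_subtype Y.mkQ_surjective ?_ ih ?_
    · intro x; simp
    · obtain ⟨I, hI, ⟨e⟩⟩ := isSimpleModule_iff_quot_maximal.mp hs
      obtain rfl := eq_maximalIdeal hI
      exact ext_equiv_subsingleton N (n+1) e.symm hk

/-- `R/m ≃ R x` for a nonzero socle element. -/
lemma residue_equiv_span {R : Type} [CommRing R] [IsLocalRing R] (x : R) (hx : x ≠ 0)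
    (hm : ∀ a ∈ maximalIdeal R, a * x = 0) :
    Nonempty (ResidueField R ≃ₗ[R] (Ideal.span {x} : Ideal R)) := by
  have h : LinearMap.ker (LinearMap.toSpanSingleton R R x) = maximalIdeal R := by
    ext a
    rw [LinearMap.mem_ker, LinearMap.toSpanSingleton_apply, smul_eq_mul]
    constructor
    · intro ha
      by_contra hc
      rw [mem_maximalIdeal, mem_nonunits_iff, not_not] at hc
      exact hx ((hc.mul_right_eq_zero).1 ha)
    · exact hm a
  have e1 := Submodule.quotEquivOfEq _ _ h.symm
  have e2 := (LinearMap.toSpanSingleton R R x).quotKerEquivRange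
  have e3 : LinearMap.range (LinearMap.toSpanSingleton R R x) ≃ₗ[R] (Ideal.span {x} : Ideal R) :=
    LinearEquiv.ofEq _ _ (LinearMap.range_toSpanSingleton x)
  exact ⟨e1 ≪≫ₗ e2 ≪≫ₗ e3⟩

lemma gor {R : Type} [CommRing R] [IsLocalRing R] [IsNoetherianRing R] [IsArtinianRing R]
    (x : R) (hx : x ≠ 0) (hm : ∀ a ∈ maximalIdeal R, a * x = 0) (n : ℕ)
    (hk : Subsingleton (extModule R (ResidueField R) R (n+1)).carrier) :
    ∀ y : R, (∀ a ∈ maximalIdeal R, a * y = 0) → y ∈ Ideal.span {x} := by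
  obtain ⟨e⟩ := residue_equiv_span x hx hm
  have key : ∀ n, Subsingleton (extModule R (ResidueField R) R (n+1)).carrier →
      Subsingleton (extModule R (R ⧸ Ideal.span {x}) R (n+1)).carrier := fun n h =>
    ext_finiteLength R n h (isFiniteLength_iff_isNoetherian_isArtinian.2
      ⟨inferInstance, inferInstance⟩)
  have hexq : Function.Exact (Ideal.span {x}).subtype (Submodule.mkQ (Ideal.span {x})) := by
    intro y; simp [Ideal.Quotient.eq_zero_iff_mem]
  induction n with
  | zero =>
    intro y hy
    have h1 := key 0 hk
    rw [ext_one_subsingleton_iff _ _ (Submodule.injective_subtype _) (Submodule.mkQ_surjective _)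
      hexq] at h1
    let lam : ResidueField R →ₗ[R] R :=
      Submodule.liftQ (maximalIdeal R) (LinearMap.toSpanSingleton R R y)
        (by intro a ha; exact hy a ha)
    obtain ⟨ψ, hψ⟩ := h1 (lam ∘ₗ e.symm.toLinearMap)
    obtain ⟨u, hu⟩ := Submodule.mkQ_surjective (maximalIdeal R)
      (e.symm ⟨x, Ideal.mem_span_singleton_self x⟩)
    have hu2 : e (Submodule.mkQ (maximalIdeal R) u) = ⟨x, Ideal.mem_span_singleton_self x⟩ := by
      rw [hu]; simp
    have h2 := LinearMap.congr_fun hψ ⟨x, Ideal.mem_span_singleton_self x⟩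
    have h3 : ψ x = u * y := by
      have h3' : ψ x = lam (e.symm ⟨x, Ideal.mem_span_singleton_self x⟩) := h2
      rw [← hu] at h3'
      exact h3'
    have h4 : ψ x = x * ψ 1 := by
      rw [← smul_eq_mul, ← map_smul, smul_eq_mul, mul_one]
    have hu' : IsUnit u := by
      by_contra hc
      have h5 : Submodule.mkQ (maximalIdeal R) u = 0 := by
        rw [Submodule.mkQ_apply, Submodule.Quotient.mk_eq_zero]; exact hc
      rw [h5] at hu2
      have := congrArg Subtype.val ((e.map_zero).symm.trans hu2)
      exact hx this.symm
    obtain ⟨v, hv⟩ := hu'.exists_left_inv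
    rw [Ideal.mem_span_singleton']
    refine ⟨v * ψ 1, ?_⟩
    calc v * ψ 1 * x = v * (x * ψ 1) := by ring
      _ = (v * u) * y := by rw [← h4, h3]; ring
      _ = y := by rw [hv, one_mul]
  | succ n ih =>
    apply ih
    have h1 := key (n+1) hk
    rw [ext_two_subsingleton_iff _ _ (Submodule.injective_subtype _) (Submodule.mkQ_surjective _)
      hexq] at h1
    exact ext_equiv_subsingleton R (n+1) e.symm h1

lemma moduleLength_eq (R M : Type) [Ring R] [AddCommGroup M] [Module R M] :
    moduleLength R M = Module.length R M := by
  have h := Order.krullDim_eq_iSup_length (α := Submodule R M)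
  rw [← Module.coe_length] at h
  exact (WithBot.coe_injective h).symm

lemma length_sub_quot {R K : Type} [Ring R] [AddCommGroup K] [Module R K] (N : Submodule R K) :
    Module.length R K = Module.length R N + Module.length R (K ⧸ N) :=
  Module.length_eq_add_of_exact N.subtype N.mkQ (Submodule.injective_subtype _)
    (Submodule.mkQ_surjective _) (LinearMap.exact_subtype_mkQ N)

lemma mem_smul_top_pi {R : Type} [CommRing R] (I : Ideal R) {n : ℕ} (c : Fin n → R) :
    c ∈ (I • ⊤ : Submodule R (Fin n → R)) ↔ ∀ i, c i ∈ I := by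
  constructor
  · intro h i
    have : (I • ⊤ : Submodule R (Fin n → R)) ≤ Submodule.comap (LinearMap.proj i) I := by
      rw [Submodule.smul_le]
      intro r hr x _
      exact I.mul_mem_right _ hr
    exact this h
  · intro h
    rw [pi_eq_sum_univ c]
    exact Submodule.sum_mem _ fun i _ => Submodule.smul_mem_smul (h i) trivial

lemma length_smul_top_pi {R : Type} [CommRing R] (I : Ideal R) (n : ℕ) :
    Module.length R (I • ⊤ : Submodule R (Fin n → R)) = n * Module.length R I := by
  let e : (I • ⊤ : Submodule R (Fin n → R)) ≃ₗ[R] (Fin n → I) :=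
    { toFun := fun c i => ⟨c.1 i, (mem_smul_top_pi I c.1).1 c.2 i⟩
      map_add' := fun _ _ => rfl
      map_smul' := fun _ _ => rfl
      invFun := fun c => ⟨fun i => (c i).1, (mem_smul_top_pi I _).2 fun i => (c i).2⟩
      left_inv := fun _ => rfl
      right_inv := fun _ => rfl }
  rw [e.length_eq, Module.length_pi_of_fintype]
  simp

lemma length_residue (R : Type) [CommRing R] [IsLocalRing R] :
    Module.length R (ResidueField R) = 1 := by
  have : IsSimpleModule R (R ⧸ maximalIdeal R) :=
    isSimpleModule_iff_quot_maximal.2 ⟨maximalIdeal R, inferInstance, ⟨LinearEquiv.refl _ _⟩⟩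
  exact Module.length_eq_one (R := R) (M := R ⧸ maximalIdeal R)

lemma length_max (R : Type) [CommRing R] [IsLocalRing R] :
    Module.length R (maximalIdeal R) =
      Module.length R (maximalIdeal R ^ 2 : Ideal R) + embdim R := by
  rw [embdim, moduleLength_eq]
  refine Module.length_eq_add_of_exact
    (Submodule.inclusion (Ideal.pow_le_self two_ne_zero)) (maximalIdeal R).toCotangent
    (Submodule.inclusion_injective _) (maximalIdeal R).toCotangent_surjective ?_
  intro x
  rw [Ideal.toCotangent_eq_zero]
  constructor
  · intro h
    exact ⟨⟨x.1, h⟩, rfl⟩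
  · rintro ⟨y, rfl⟩
    exact y.2

lemma hom_residue_zero {R : Type} [CommRing R] [IsLocalRing R] {X : Type} [AddCommGroup X]
    [Module R X] (φ : X →ₗ[R] ResidueField R) (x : X)
    (hx : x ∈ (maximalIdeal R • ⊤ : Submodule R X)) : φ x = 0 := by
  have : (maximalIdeal R • ⊤ : Submodule R X) ≤ LinearMap.ker φ := by
    rw [Submodule.smul_le]
    intro r hr x _
    rw [LinearMap.mem_ker, map_smul, Algebra.smul_def]
    have : algebraMap R (ResidueField R) r = 0 := (residue_eq_zero_iff r).2 hr
    rw [this, zero_mul]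
  exact this hx

/-- A module with a socle element outside `mX` has `k` as a summand. -/
lemma soc_le {R : Type} [CommRing R] [IsLocalRing R] {X : Type} [AddCommGroup X] [Module R X]
    (hX : ¬ kSummand R X) (x : X) (hx : ∀ a ∈ maximalIdeal R, a • x = 0) :
    x ∈ (maximalIdeal R • ⊤ : Submodule R X) := by
  by_contra hc
  apply hX
  let V := X ⧸ (maximalIdeal R • ⊤ : Submodule R X)
  let _ : Field (R ⧸ maximalIdeal R) := Ideal.Quotient.field _
  have hv : (Submodule.Quotient.mk x : V) ≠ 0 := by
    rwa [Ne, Submodule.Quotient.mk_eq_zero]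
  obtain ⟨φ, hφ⟩ := Module.Projective.exists_dual_eq_one (R ⧸ maximalIdeal R) hv
  let f : X →ₗ[R] ResidueField R := (φ.restrictScalars R) ∘ₗ Submodule.mkQ _
  let g : ResidueField R →ₗ[R] X :=
    Submodule.liftQ (maximalIdeal R) (LinearMap.toSpanSingleton R X x)
      (by intro a ha; exact hx a ha)
  refine ⟨f, g, ?_⟩
  have hfx : f x = 1 := hφ
  ext y
  obtain ⟨r, rfl⟩ := residue_surjective y
  have h1 : g (residue R r) = r • x := rfl
  rw [LinearMap.comp_apply, h1, map_smul, hfx, Algebra.smul_def, mul_one]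
  rfl

lemma exists_min_cover (R : Type) [CommRing R] [IsLocalRing R] (X : Type) [AddCommGroup X]
    [Module R X] [Module.Finite R X] :
    ∃ (n : ℕ) (p : (Fin n → R) →ₗ[R] X), Function.Surjective p ∧
      LinearMap.ker p ≤ maximalIdeal R • ⊤ := by
  let w := Module.finBasis (ResidueField R) (TensorProduct R (ResidueField R) X)
  obtain ⟨v, hv⟩ := (TensorProduct.mk_surjective R X (ResidueField R)
    Ideal.Quotient.mk_surjective).comp_left w
  have hv' : ∀ i, TensorProduct.mk R (ResidueField R) X 1 (v i) = w i := fun i => congrFun hv i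
  refine ⟨_, Fintype.linearCombination R v, ?_, ?_⟩
  · rw [← LinearMap.range_eq_top, Fintype.range_linearCombination]
    exact IsLocalRing.span_eq_top_of_tmul_eq_basis v w hv'
  · intro c hc
    rw [mem_smul_top_pi]
    intro i
    rw [LinearMap.mem_ker, Fintype.linearCombination_apply] at hc
    have h1 := congrArg (TensorProduct.mk R (ResidueField R) X 1) hc
    simp only [map_sum, map_smul, hv', map_zero] at h1
    have h2 : ∑ j, (residue R (c j)) • w j = 0 := by
      rw [← h1]
      refine Finset.sum_congr rfl fun j _ => ?_
      rw [← algebraMap_smul (ResidueField R) (c j) (w j)]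
      rfl
    have h3 := Fintype.linearIndependent_iff.1 w.linearIndependent _ h2 i
    exact (residue_eq_zero_iff _).1 h3

section cover
variable {R : Type} [CommRing R] [IsLocalRing R] {X : Type} [AddCommGroup X] [Module R X]
  {n : ℕ} (p : (Fin n → R) →ₗ[R] X)

lemma betti_zero_eq_hom (R : Type) [CommRing R] [IsLocalRing R] (X : Type) [AddCommGroup X]
    [Module R X] :
    bettiNum R X 0 = Module.length R (X →ₗ[R] ResidueField R) := by
  obtain ⟨e⟩ := ext_zero_equiv (R := R) X (ResidueField R)
  rw [bettiNum, moduleLength_eq, e.length_eq]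

lemma betti_zero (hp : Function.Surjective p)
    (hker : LinearMap.ker p ≤ maximalIdeal R • ⊤) : bettiNum R X 0 = n := by
  rw [betti_zero_eq_hom]
  have e1 := homKerEquiv _ _ (ResidueField R) hp (exact_ker p)
  have h : LinearMap.ker (LinearMap.lcomp R (ResidueField R) (LinearMap.ker p).subtype) = ⊤ := by
    rw [eq_top_iff]
    intro φ _
    rw [LinearMap.mem_ker]
    ext x
    exact hom_residue_zero φ x.1 (hker x.2)
  have e2 : Module.length R (X →ₗ[R] ResidueField R) = Module.length R
      (LinearMap.ker (LinearMap.lcomp R (ResidueField R) (LinearMap.ker p).subtype)) :=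
    LinearEquiv.length_eq (R := R) (M := X →ₗ[R] ResidueField R)
      (N := (LinearMap.ker (LinearMap.lcomp R (ResidueField R) (LinearMap.ker p).subtype))) e1
  rw [e2, h, Module.length_top,
    ← ((Pi.basisFun R (Fin n)).constr R (M' := ResidueField R)).length_eq,
    Module.length_pi_of_fintype]
  simp [length_residue]

lemma length_top_quot (hp : Function.Surjective p)
    (hker : LinearMap.ker p ≤ maximalIdeal R • ⊤) : Module.length R (X ⧸ (maximalIdeal R • ⊤ : Submodule R X)) = n := by
  let q : (Fin n → R) →ₗ[R] X ⧸ (maximalIdeal R • ⊤ : Submodule R X) := Submodule.mkQ _ ∘ₗ p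
  have hq : Function.Surjective q := (Submodule.mkQ_surjective _).comp hp
  have hqk : LinearMap.ker q = maximalIdeal R • ⊤ := by
    have h1 : (maximalIdeal R • ⊤ : Submodule R X) =
        Submodule.map p (maximalIdeal R • ⊤) := by
      rw [Submodule.map_smul'', Submodule.map_top, LinearMap.range_eq_top.2 hp]
    rw [LinearMap.ker_comp, Submodule.ker_mkQ, h1, Submodule.comap_map_eq, sup_eq_left]
    exact hker
  let s : (Fin n → R) →ₗ[R] (Fin n → ResidueField R) :=
    LinearMap.pi fun i => (Algebra.linearMap R (ResidueField R)) ∘ₗ LinearMap.proj i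
  have hs : Function.Surjective s := by
    intro y
    choose c hc using fun i => residue_surjective (y i)
    exact ⟨c, funext hc⟩
  have hsk : LinearMap.ker s = maximalIdeal R • ⊤ := by
    ext c
    rw [mem_smul_top_pi, LinearMap.mem_ker, funext_iff]
    exact forall_congr' fun i => residue_eq_zero_iff (c i)
  rw [← (q.quotKerEquivOfSurjective hq).length_eq,
    (Submodule.quotEquivOfEq _ _ (hqk.trans hsk.symm)).length_eq,
    (s.quotKerEquivOfSurjective hs).length_eq, Module.length_pi_of_fintype]
  simp [length_residue]

lemma betti_succ (hp : Function.Surjective p)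
    (hker : LinearMap.ker p ≤ maximalIdeal R • ⊤) (i : ℕ) : bettiNum R X (i+1) = bettiNum R (LinearMap.ker p) i := by
  cases i with
  | zero =>
    rw [betti_zero_eq_hom]
    obtain ⟨e⟩ := ext_one_equiv _ _ (Submodule.injective_subtype _) hp (exact_ker p)
      (ResidueField R)
    have h : LinearMap.range (LinearMap.lcomp R (ResidueField R) (LinearMap.ker p).subtype) = ⊥ := by
      rw [eq_bot_iff]
      rintro _ ⟨φ, rfl⟩
      rw [Submodule.mem_bot]
      ext x
      exact hom_residue_zero φ x.1 (hker x.2)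
    rw [bettiNum, moduleLength_eq, e.length_eq, (Submodule.quotEquivOfEqBot _ h).length_eq]
  | succ i =>
    obtain ⟨e⟩ := ext_two_equiv _ _ (Submodule.injective_subtype _) hp (exact_ker p)
      (ResidueField R) i
    rw [bettiNum, bettiNum, moduleLength_eq, moduleLength_eq, e.length_eq]

lemma min_map_eq (hp : Function.Surjective p)
    (hker : LinearMap.ker p ≤ maximalIdeal R • ⊤) (h3 : maximalIdeal R ^ 3 = ⊥)
    (hX : maximalIdeal R ^ 2 • (⊤ : Submodule R X) = ⊥) (hk : ¬ kSummand R (LinearMap.ker p)) :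
    (maximalIdeal R • (⊤ : Submodule R (LinearMap.ker p))).map (LinearMap.ker p).subtype =
      maximalIdeal R ^ 2 • ⊤ := by
  apply le_antisymm
  · rw [Submodule.map_smul'', Submodule.map_top, Submodule.range_subtype, pow_two,
      Submodule.mul_smul]
    exact smul_mono_right _ hker
  · intro x hx
    have hxK : x ∈ LinearMap.ker p := by
      have : p x ∈ Submodule.map p (maximalIdeal R ^ 2 • ⊤) := ⟨x, hx, rfl⟩
      rw [Submodule.map_smul'', Submodule.map_top, LinearMap.range_eq_top.2 hp, hX] at this
      exact this
    refine ⟨⟨x, hxK⟩, ?_, rfl⟩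
    apply soc_le hk
    intro a ha
    apply Subtype.ext
    funext i
    have h1 := (mem_smul_top_pi _ x).1 hx i
    have h2 : a * x i ∈ maximalIdeal R ^ 3 := by
      rw [pow_succ']; exact Ideal.mul_mem_mul ha h1
    rw [h3] at h2
    exact h2

lemma length_min (hp : Function.Surjective p)
    (hker : LinearMap.ker p ≤ maximalIdeal R • ⊤) [IsNoetherianRing R] [IsArtinianRing R] (h3 : maximalIdeal R ^ 3 = ⊥)
    (hX : maximalIdeal R ^ 2 • (⊤ : Submodule R X) = ⊥) (hk : ¬ kSummand R (LinearMap.ker p)) :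
    bettiNum R X 1 + moduleLength R (↥(maximalIdeal R • (⊤ : Submodule R X)))
      = embdim R * bettiNum R X 0 := by
  obtain ⟨n1, p1, hp1, hker1⟩ := exists_min_cover R (LinearMap.ker p)
  rw [betti_succ p hp hker, betti_zero p1 hp1 hker1, betti_zero p hp hker, moduleLength_eq]
  have hq := length_top_quot p1 hp1 hker1
  set K := LinearMap.ker p
  -- length K
  have l1 : Module.length R K = Module.length R (maximalIdeal R • ⊤ : Submodule R K) +
      Module.length R (K ⧸ (maximalIdeal R • ⊤ : Submodule R K)) :=
    length_sub_quot _
  rw [hq] at l1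
  have l2 : Module.length R (maximalIdeal R • ⊤ : Submodule R K) =
      n * Module.length R (maximalIdeal R ^ 2 : Ideal R) := by
    rw [← length_smul_top_pi, ← min_map_eq p hp hker h3 hX hk]
    exact (Submodule.equivMapOfInjective _ (Submodule.injective_subtype _) _).length_eq
  -- length mF
  have hpm : ∀ x ∈ (maximalIdeal R • ⊤ : Submodule R (Fin n → R)),
      p x ∈ (maximalIdeal R • ⊤ : Submodule R X) := by
    intro x hx
    have : p x ∈ Submodule.map p (maximalIdeal R • ⊤) := ⟨x, hx, rfl⟩
    rwa [Submodule.map_smul'', Submodule.map_top, LinearMap.range_eq_top.2 hp] at this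
  have l3 := Module.length_eq_add_of_exact (Submodule.inclusion hker) (p.restrict hpm)
    (Submodule.inclusion_injective _) (by
      rintro ⟨y, hy⟩
      have h1 : y ∈ Submodule.map p (maximalIdeal R • ⊤) := by
        rwa [Submodule.map_smul'', Submodule.map_top, LinearMap.range_eq_top.2 hp]
      obtain ⟨x, hx, rfl⟩ := h1
      exact ⟨⟨x, hx⟩, rfl⟩) (by
      rintro ⟨x, hx⟩
      constructor
      · intro h
        exact ⟨⟨x, congrArg Subtype.val h⟩, rfl⟩
      · rintro ⟨y, hy⟩
        apply Subtype.ext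
        rw [← hy]
        exact y.2)
  rw [length_smul_top_pi, length_max, l1, l2] at l3
  have fin : (n : ℕ∞) * Module.length R (maximalIdeal R ^ 2 : Ideal R) ≠ ⊤ := by
    rw [← length_smul_top_pi]
    exact Module.length_ne_top
  rw [mul_add, add_assoc] at l3
  have := ENat.add_right_injective_of_ne_top fin l3
  rw [← this, mul_comm]
end cover

lemma socle_mem {R : Type} [CommRing R] [IsLocalRing R] {x : R} :
    x ∈ socle R ↔ ∀ a ∈ maximalIdeal R, a * x = 0 := by
  rw [socle, Submodule.mem_colon]
  simp only [smul_eq_mul, Submodule.mem_bot, mul_comm x]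
  rfl

section main
variable {R : Type} [CommRing R] [IsLocalRing R]

lemma ext_residue_ne [IsNoetherianRing R]
    (h3 : maximalIdeal R ^ 3 = ⊥) (h2 : maximalIdeal R ^ 2 ≠ ⊥) (hnotGor : 2 ≤ socdim R)
    [IsArtinianRing R] (n : ℕ) :
    ¬ Subsingleton (extModule R (ResidueField R) R (n+1)).carrier := by
  intro hk
  obtain ⟨x, hx, hx0⟩ := (Submodule.ne_bot_iff _).1 h2
  have hm : ∀ a ∈ maximalIdeal R, a * x = 0 := by
    intro a ha
    have : a * x ∈ maximalIdeal R ^ 3 := by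
      rw [pow_succ']; exact Ideal.mul_mem_mul ha hx
    rw [h3] at this
    exact this
  have hg := gor x hx0 hm n hk
  obtain ⟨e⟩ := residue_equiv_span x hx0 hm
  have hle : socle R ≤ Ideal.span {x} := fun y hy => hg y (socle_mem.1 hy)
  rw [socdim, moduleLength_eq] at hnotGor
  have := Module.length_le_of_injective (R := R) (Submodule.inclusion hle)
    (Submodule.inclusion_injective _)
  rw [← e.length_eq, length_residue] at this
  exact absurd (hnotGor.trans this) (by decide)

lemma not_kSummand [IsNoetherianRing R]
    (h3 : maximalIdeal R ^ 3 = ⊥) (h2 : maximalIdeal R ^ 2 ≠ ⊥) (hnotGor : 2 ≤ socdim R)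
    [IsArtinianRing R] {X : Type} [AddCommGroup X] [Module R X] (n : ℕ)
    (hX : Subsingleton (extModule R X R (n+1)).carrier) : ¬ kSummand R X := by
  rintro ⟨f, g, hfg⟩
  exact ext_residue_ne h3 h2 hnotGor n (ext_retract R (n+1) f g hfg hX)

lemma ker_sq (h3 : maximalIdeal R ^ 3 = ⊥) {X : Type} [AddCommGroup X] [Module R X] {n : ℕ} (p : (Fin n → R) →ₗ[R] X)
    (hker : LinearMap.ker p ≤ maximalIdeal R • ⊤) :
    maximalIdeal R ^ 2 • (⊤ : Submodule R (LinearMap.ker p)) = ⊥ := by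
  apply Submodule.map_injective_of_injective (Submodule.injective_subtype _)
  rw [Submodule.map_smul'', Submodule.map_top, Submodule.range_subtype, Submodule.map_bot,
    eq_bot_iff]
  refine (smul_mono_right _ hker).trans ?_
  rw [← Submodule.mul_smul, ← pow_succ, h3, Submodule.bot_smul]

lemma rec_aux [IsNoetherianRing R]
    (h3 : maximalIdeal R ^ 3 = ⊥) (h2 : maximalIdeal R ^ 2 ≠ ⊥) (hnotGor : 2 ≤ socdim R)
    [IsArtinianRing R] (hsoc : socle R = maximalIdeal R ^ 2) (j : ℕ) :
    ∀ (X : Type) [AddCommGroup X] [Module R X] [Module.Finite R X]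
      (_ : maximalIdeal R ^ 2 • (⊤ : Submodule R X) = ⊥) (h : ℕ) (_ : j ≤ h)
      (_ : Subsingleton (extModule R X R (h + 3)).carrier),
      bettiNum R X (j + 2) + socdim R * bettiNum R X j = embdim R * bettiNum R X (j + 1) := by
  induction j with
  | zero =>
    intro X _ _ _ hX h _ hext
    obtain ⟨n, p, hp, hker⟩ := exists_min_cover R X
    rw [ext_two_subsingleton_iff _ _ (Submodule.injective_subtype _) hp (exact_ker p)] at hext
    obtain ⟨n1, p1, hp1, hker1⟩ := exists_min_cover R (LinearMap.ker p)
    have hext1 := hext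
    rw [ext_two_subsingleton_iff _ _ (Submodule.injective_subtype _) hp1 (exact_ker p1)] at hext1
    have key := length_min p1 hp1 hker1 h3 (ker_sq h3 p hker)
      (not_kSummand h3 h2 hnotGor _ hext1)
    rw [betti_succ p hp hker, betti_succ p hp hker, betti_zero p hp hker, ← key]
    congr 1
    rw [socdim, moduleLength_eq, moduleLength_eq, hsoc, mul_comm, ← length_smul_top_pi,
      ← min_map_eq p hp hker h3 hX (not_kSummand h3 h2 hnotGor _ hext)]
    exact (Submodule.equivMapOfInjective _ (Submodule.injective_subtype _) _).symm.length_eq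
  | succ j ih =>
    intro X _ _ _ hX h hj hext
    obtain ⟨n, p, hp, hker⟩ := exists_min_cover R X
    rw [ext_two_subsingleton_iff _ _ (Submodule.injective_subtype _) hp (exact_ker p)] at hext
    obtain ⟨h, rfl⟩ : ∃ h', h = h' + 1 := ⟨h - 1, by omega⟩
    have := ih (LinearMap.ker p) (ker_sq h3 p hker) h (by omega) hext
    rw [betti_succ p hp hker, betti_succ p hp hker, betti_succ p hp hker]
    exact this

lemma socle_eq [IsNoetherianRing R]
    (h3 : maximalIdeal R ^ 3 = ⊥) (h2 : maximalIdeal R ^ 2 ≠ ⊥) (hnotGor : 2 ≤ socdim R)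
    [IsArtinianRing R] (X : Type) [AddCommGroup X] [Module R X] [Module.Finite R X]
    [Nontrivial X] (hX : maximalIdeal R ^ 2 • (⊤ : Submodule R X) = ⊥) (h : ℕ)
    (hext : Subsingleton (extModule R X R (h + 3)).carrier) :
    socle R = maximalIdeal R ^ 2 := by
  obtain ⟨n, p, hp, hker⟩ := exists_min_cover R X
  rw [ext_two_subsingleton_iff _ _ (Submodule.injective_subtype _) hp (exact_ker p)] at hext
  obtain ⟨n1, p1, hp1, hker1⟩ := exists_min_cover R (LinearMap.ker p)
  rw [ext_two_subsingleton_iff _ _ (Submodule.injective_subtype _) hp1 (exact_ker p1)] at hext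
  have hk := not_kSummand h3 h2 hnotGor _ hext
  have hn : 0 < n := by
    rcases Nat.eq_zero_or_pos n with rfl | h
    · have := hp.subsingleton
      exact absurd this (not_subsingleton X)
    · exact h
  have hn1 : 0 < n1 := by
    rcases Nat.eq_zero_or_pos n1 with rfl | h
    · exfalso
      have hs := hp1.subsingleton
      apply h2
      rw [eq_bot_iff]
      intro a ha
      have h1 : (fun _ => a : Fin n → R) ∈ LinearMap.ker p := by
        have h4 : (fun _ => a : Fin n → R) ∈ (maximalIdeal R ^ 2 • ⊤ : Submodule R (Fin n → R)) :=
          (mem_smul_top_pi _ _).2 fun _ => ha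
        have : p (fun _ => a) ∈ Submodule.map p (maximalIdeal R ^ 2 • ⊤) := ⟨_, h4, rfl⟩
        rw [Submodule.map_smul'', Submodule.map_top, LinearMap.range_eq_top.2 hp, hX] at this
        exact this
      have h5 := congrArg Subtype.val (hs.elim ⟨_, h1⟩ 0)
      exact congrFun h5 ⟨0, hn⟩
    · exact h
  apply le_antisymm
  · intro x hx
    rw [socle_mem] at hx
    have hxm : x ∈ maximalIdeal R := by
      by_contra hc
      rw [mem_maximalIdeal, mem_nonunits_iff, not_not] at hc
      apply h2
      rw [eq_bot_iff]
      intro a ha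
      exact (hc.mul_left_eq_zero).1 (hx a (Ideal.pow_le_self two_ne_zero ha))
    let v : Fin n1 → R := x • (fun _ => 1)
    have hv : v ∈ LinearMap.ker p1 := by
      rw [LinearMap.mem_ker, map_smul]
      apply Subtype.ext
      funext i
      have h6 := (mem_smul_top_pi _ _).1 (hker (p1 fun _ => 1).2) i
      have h7 := hx _ h6
      rw [mul_comm] at h7
      exact h7
    have h8 := soc_le hk ⟨v, hv⟩ (by
      intro a ha
      apply Subtype.ext
      funext i
      have : a * (x * 1) = 0 := by rw [mul_one]; exact hx a ha
      exact this)
    have h9 : v ∈ Submodule.map (LinearMap.ker p1).subtype (maximalIdeal R • ⊤) := ⟨_, h8, rfl⟩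
    rw [Submodule.map_smul'', Submodule.map_top, Submodule.range_subtype] at h9
    have h10 := smul_mono_right (maximalIdeal R) hker1 h9
    rw [← Submodule.mul_smul, ← pow_two, mem_smul_top_pi] at h10
    have := h10 ⟨0, hn1⟩
    simpa [v] using this
  · intro x hx
    rw [socle_mem]
    intro a ha
    have : a * x ∈ maximalIdeal R ^ 3 := by
      rw [pow_succ']; exact Ideal.mul_mem_mul ha hx
    rw [h3] at this
    exact this
end main

/-- Let `(R, m, k)` be a local ring with `m³ = 0 ≠ m²` which is not Gorenstein
(equivalently, `r ≥ 2`).  If `M` is a nonzero finitely generated `R`-module with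
`m²M = 0` and `Ext^{h+1}_R(M, R) = 0` for some `h ≥ 2`, then `(0 :_R m) = m²`,
`β₁(M) = e·β₀(M) − dim_k(mM)` and `β_i(M) = e·β_{i−1}(M) − r·β_{i−2}(M)` for
`2 ≤ i ≤ h` (the displayed equalities are stated in rearranged, subtraction-free
form); that is, `M` is `h`-exceptional. -/
theorem h_exceptional (R : Type) [CommRing R] [IsNoetherianRing R] [IsLocalRing R]
    (h3 : maximalIdeal R ^ 3 = ⊥) (h2 : maximalIdeal R ^ 2 ≠ ⊥)
    (hnotGor : 2 ≤ socdim R)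
    (M : Type) [AddCommGroup M] [Module R M] [Module.Finite R M] [Nontrivial M]
    (hM : maximalIdeal R ^ 2 • (⊤ : Submodule R M) = ⊥)
    (h : ℕ) (hh : 2 ≤ h) (hext : Subsingleton (extModule R M R (h + 1)).carrier) :
    socle R = maximalIdeal R ^ 2 ∧
    bettiNum R M 1 + moduleLength R (↥(maximalIdeal R • (⊤ : Submodule R M)))
      = embdim R * bettiNum R M 0 ∧
    ∀ i : ℕ, 2 ≤ i → i ≤ h →
      bettiNum R M i + socdim R * bettiNum R M (i - 2) = embdim R * bettiNum R M (i - 1) := by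
  have hart : IsArtinianRing R := (isArtinianRing_iff_isNilpotent_maximalIdeal R).2 ⟨3, h3⟩
  obtain ⟨h, rfl⟩ : ∃ h', h = h' + 2 := ⟨h - 2, by omega⟩
  have hsoc := socle_eq h3 h2 hnotGor M hM h hext
  refine ⟨hsoc, ?_, ?_⟩
  · obtain ⟨n, p, hp, hker⟩ := exists_min_cover R M
    refine length_min p hp hker h3 hM (not_kSummand h3 h2 hnotGor (h+1) ?_)
    rwa [ext_two_subsingleton_iff _ _ (Submodule.injective_subtype _) hp (exact_ker p)] at hext
  · intro i hi hih
    obtain ⟨j, rfl⟩ : ∃ j, i = j + 2 := ⟨i - 2, by omega⟩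
    exact rec_aux h3 h2 hnotGor hsoc j M hM h (by omega) hext
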